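/- Let f ≥ 2 and work in S_{2f}. Then 𝕤_1 · 𝔻_{(1,f−2)}^{{2,…,f}} · H_f(2f) = (𝕤_1 · H_2^{{1,…,4}}) · H_{f−2}^{{5,…,2f}} · D_{(3,2f−4)}^{{2,…,2f}} as subsets of S_{2f}, where 𝔻_{(1,f−2)}^{{2,…,f}} = {𝕤_2𝕤_3⋯𝕤_k : k = 1,…,f−1} (k = 1 giving the identity); moreover every element of this set factors uniquely as a·b·c with a ∈ 𝕤_1H_2^{{1,…,4}}, b ∈ H_{f−2}^{{5,…,2f}}, c ∈ D_{(3,2f−4)}^{{2,…,2f}}, with ℓ(abc) = ℓ(a) + ℓ(b) + ℓ(c). Equivalently, this set equals the set of d ∈ D_{(2,2,…,2)} (f twos) with (3)d < (5)d < ⋯ < (2f−1)d and (1)d > (3)d. -/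

import Mathlib

open Finset
open scoped Pointwise

namespace BMWPaper

/-- The Coxeter length of a permutation of `Fin n`: the number of inversions. -/
def len {n : ℕ} (w : Equiv.Perm (Fin n)) : ℕ :=
  (Finset.univ.filter (fun p : Fin n × Fin n => p.1 < p.2 ∧ w p.2 < w p.1)).card

/-- `sGen n i` is the adjacent transposition `s_i = (i, i+1)` (1-based) in `S_n`;
it is the identity for out-of-range `i`. -/
def sGen (n i : ℕ) : Equiv.Perm (Fin n) :=
  if h : 1 ≤ i ∧ i < n then Equiv.swap ⟨i - 1, by omega⟩ ⟨i, h.2⟩ else 1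

/-- `pimg d i` is the (1-based) image `(i)d` of the point `i ∈ {1,…,n}` under the
*right* action of the permutation `d` (permutations act on points on the right,
so that `(a)(στ) = ((a)σ)τ` for the group multiplication `σ * τ`);
the junk value `0` is returned for out-of-range `i`. -/
def pimg {n : ℕ} (d : Equiv.Perm (Fin n)) (i : ℕ) : ℕ :=
  if h : i - 1 < n then ((d⁻¹ ⟨i - 1, h⟩ : Fin n) : ℕ) + 1 else 0

open scoped Classical in
/-- `Hset n f` is the set `H_f(n)` of all `d ∈ S_n` such that
`(1)d < (3)d < ⋯ < (2f-1)d`, `(2i-1)d < (2i)d` for `i = 1,…,f`, and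
`(2f+1)d < (2f+2)d < ⋯ < (n)d`. -/
noncomputable def Hset (n f : ℕ) : Finset (Equiv.Perm (Fin n)) :=
  Finset.univ.filter (fun d =>
    (∀ i ∈ Finset.Icc 1 (f - 1), pimg d (2 * i - 1) < pimg d (2 * i + 1)) ∧
    (∀ i ∈ Finset.Icc 1 f, pimg d (2 * i - 1) < pimg d (2 * i)) ∧
    (∀ j ∈ Finset.Icc (2 * f + 1) (n - 1), pimg d j < pimg d (j + 1)))

/-- The index of the block of the composition `μ` containing the (0-based) point `k`. -/
def blockOf (μ : List ℕ) (k : ℕ) : ℕ :=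
  ((List.range μ.length).filter (fun j => (μ.take (j + 1)).sum ≤ k)).length

open scoped Classical in
/-- The Young subgroup `S_μ` of `S_n` associated with a composition `μ` of `n`,
as the set of permutations preserving each of the consecutive blocks of `μ`. -/
noncomputable def youngSet (n : ℕ) (μ : List ℕ) : Finset (Equiv.Perm (Fin n)) :=
  Finset.univ.filter (fun w => ∀ a : Fin n, blockOf μ ((w a : ℕ)) = blockOf μ (a : ℕ))

open scoped Classical in
/-- The set `D_μ` of minimal-length right coset representatives of `S_μ` in `S_n`:
the elements of minimal length in their right coset `S_μ d`. -/
noncomputable def Dset (n : ℕ) (μ : List ℕ) : Finset (Equiv.Perm (Fin n)) :=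
  Finset.univ.filter (fun d => ∀ u ∈ youngSet n μ, len d ≤ len (u * d))

/-- The identification of `Fin m` with the block `[k, k+m)` of `Fin n` (0-based). -/
def shiftEquiv (n k m : ℕ) (h : k + m ≤ n) :
    Fin m ≃ {a : Fin n // k ≤ (a : ℕ) ∧ (a : ℕ) < k + m} where
  toFun b := ⟨⟨k + (b : ℕ), by have := b.isLt; omega⟩, by
    constructor
    · exact Nat.le_add_right _ _
    · have := b.isLt; simp only [Fin.val_mk]; omega⟩
  invFun a := ⟨(a : Fin n) - k, by have := a.2; omega⟩
  left_inv b := by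
    apply Fin.ext
    simp
  right_inv a := by
    apply Subtype.ext
    apply Fin.ext
    have := a.2
    simp only []
    omega

open scoped Classical in
/-- The embedding of `S_m` into `S_n` as the group of permutations of the
(1-based) block `{k+1, …, k+m}` of `{1, …, n}`. -/
noncomputable def shiftEmb (n k m : ℕ) (w : Equiv.Perm (Fin m)) : Equiv.Perm (Fin n) :=
  if h : k + m ≤ n then w.extendDomain (shiftEquiv n k m h) else 1

open scoped Classical in
/-- The subgroup of `S_n` of permutations fixing the (1-based) points `1, …, k`. -/
noncomputable def fixSet (n k : ℕ) : Finset (Equiv.Perm (Fin n)) :=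
  Finset.univ.filter (fun w => ∀ a : Fin n, (a : ℕ) < k → w a = a)


/-- `bbs n i` is the permutation `𝕤_i = s_{2i} s_{2i-1} s_{2i+1} s_{2i} = (2i-1, 2i+1)(2i, 2i+2)`. -/
def bbs (n i : ℕ) : Equiv.Perm (Fin n) :=
  sGen n (2 * i) * sGen n (2 * i - 1) * sGen n (2 * i + 1) * sGen n (2 * i)

open scoped Classical in
/-- The set `𝔻_{(1,f-1)} = {𝕤_1 𝕤_2 ⋯ 𝕤_k : k = 0, …, f-1}` in `S_{2f}`. -/
noncomputable def bbD1 (f : ℕ) : Finset (Equiv.Perm (Fin (2 * f))) :=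
  (Finset.range f).image (fun k => ((List.range k).map (fun j => bbs (2 * f) (j + 1))).prod)

open scoped Classical in
/-- The set `𝔻_{(1,f-2)}^{{2,…,f}} = {𝕤_2 𝕤_3 ⋯ 𝕤_k : k = 1, …, f-1}` in `S_{2f}`. -/
noncomputable def bbD1' (f : ℕ) : Finset (Equiv.Perm (Fin (2 * f))) :=
  (Finset.Icc 1 (f - 1)).image
    (fun k => ((List.range (k - 1)).map (fun j => bbs (2 * f) (j + 2))).prod)

open scoped Classical in
/-- `H_f^{(a)} = {d ∈ H_f(n) : (1)d⁻¹ = 1, (2)d⁻¹ = 2}`. -/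
noncomputable def HsetA (n f : ℕ) : Finset (Equiv.Perm (Fin n)) :=
  (Hset n f).filter (fun d => pimg d⁻¹ 1 = 1 ∧ pimg d⁻¹ 2 = 2)

open scoped Classical in
/-- `H_f^{(b)} = {d ∈ H_f(n) : (1)d⁻¹ = 1, (2)d⁻¹ = 3}`. -/
noncomputable def HsetB (n f : ℕ) : Finset (Equiv.Perm (Fin n)) :=
  (Hset n f).filter (fun d => pimg d⁻¹ 1 = 1 ∧ pimg d⁻¹ 2 = 3)

open scoped Classical in
/-- `H_f^{(c)} = {d ∈ H_f(n) : (1)d⁻¹ = 1, (2)d⁻¹ = 2f+1}`. -/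
noncomputable def HsetC (n f : ℕ) : Finset (Equiv.Perm (Fin n)) :=
  (Hset n f).filter (fun d => pimg d⁻¹ 1 = 1 ∧ pimg d⁻¹ 2 = 2 * f + 1)

open scoped Classical in
/-- `H_f^{(d)} = {d ∈ H_f(n) : (1)d⁻¹ = 2f+1, (2)d⁻¹ = 1}`. -/
noncomputable def HsetD (n f : ℕ) : Finset (Equiv.Perm (Fin n)) :=
  (Hset n f).filter (fun d => pimg d⁻¹ 1 = 2 * f + 1 ∧ pimg d⁻¹ 2 = 1)

open scoped Classical in
/-- `H_f^{(e)} = {d ∈ H_f(n) : (1)d⁻¹ = 2f+1, (2)d⁻¹ = 2f+2}`. -/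
noncomputable def HsetE (n f : ℕ) : Finset (Equiv.Perm (Fin n)) :=
  (Hset n f).filter (fun d => pimg d⁻¹ 1 = 2 * f + 1 ∧ pimg d⁻¹ 2 = 2 * f + 2)

section Algebra

variable {F : Type*} [Field F] {A : Type*} [Ring A] [Algebra F A]

/-- For a set `S` of permutations, `hat c Tw S = Σ_{w ∈ S} c^{ℓ(w)} T_w`. -/
noncomputable def hat {n : ℕ} (c : F) (Tw : Equiv.Perm (Fin n) → A)
    (S : Finset (Equiv.Perm (Fin n))) : A :=
  ∑ w ∈ S, c ^ len w • Tw w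

/-- `Ehat E f = E_1 E_3 ⋯ E_{2f-1}`. -/
def Ehat (E : ℕ → A) (f : ℕ) : A := ((List.range f).map (fun i => E (2 * i + 1))).prod

/-- `Tprod T a b = T_a T_{a+1} ⋯ T_b` (the empty product `1` if `b < a`). -/
def Tprod (T : ℕ → A) (a b : ℕ) : A := ((List.range (b + 1 - a)).map (fun t => T (a + t))).prod

/-- `sDesc n a b = s_a s_{a-1} ⋯ s_b` (descending product of adjacent transpositions). -/
def sDesc (n a b : ℕ) : Equiv.Perm (Fin n) :=
  ((List.range (a + 1 - b)).map (fun j => sGen n (a - j))).prod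

/-- The data of a Birman–Murakami–Wenzl algebra structure: an `F`-algebra `A`
with invertible elements `T_1, …, T_{n-1}` and elements `E_1, …, E_{n-1}`
satisfying the BMW relations, together with a map `w ↦ T_w` from `S_n` to `A`
with `T_id = 1`, `T_{s_i} = T_i` and `T_{uv} = T_u T_v` whenever lengths add. -/
structure BMWData (F : Type*) [Field F] (A : Type*) [Ring A] [Algebra F A]
    (n : ℕ) (q r : F) where
  T : ℕ → A
  Tinv : ℕ → A
  E : ℕ → A
  Tw : Equiv.Perm (Fin n) → A
  hq : q ≠ 0
  hr : r ≠ 0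
  hqq : q - q⁻¹ ≠ 0
  T_mul_Tinv : ∀ i, 1 ≤ i → i ≤ n - 1 → T i * Tinv i = 1
  Tinv_mul_T : ∀ i, 1 ≤ i → i ≤ n - 1 → Tinv i * T i = 1
  skein : ∀ i, 1 ≤ i → i ≤ n - 1 → T i - Tinv i = (q - q⁻¹) • (1 - E i)
  Esq : ∀ i, 1 ≤ i → i ≤ n - 1 → E i * E i = (1 + (r - r⁻¹) / (q - q⁻¹)) • E i
  braid : ∀ i, 1 ≤ i → i + 1 ≤ n - 1 → T i * T (i + 1) * T i = T (i + 1) * T i * T (i + 1)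
  T_comm : ∀ i j, 1 ≤ i → i ≤ n - 1 → 1 ≤ j → j ≤ n - 1 → (i + 1 < j ∨ j + 1 < i) →
    T i * T j = T j * T i
  EEE₁ : ∀ i, 1 ≤ i → i + 1 ≤ n - 1 → E i * E (i + 1) * E i = E i
  EEE₂ : ∀ i, 1 ≤ i → i + 1 ≤ n - 1 → E (i + 1) * E i * E (i + 1) = E (i + 1)
  TTE₁ : ∀ i, 1 ≤ i → i + 1 ≤ n - 1 → T i * T (i + 1) * E i = E (i + 1) * E i
  TTE₂ : ∀ i, 1 ≤ i → i + 1 ≤ n - 1 → T (i + 1) * T i * E (i + 1) = E i * E (i + 1)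
  ET : ∀ i, 1 ≤ i → i ≤ n - 1 → E i * T i = r⁻¹ • E i
  TE : ∀ i, 1 ≤ i → i ≤ n - 1 → T i * E i = r⁻¹ • E i
  ETE₁ : ∀ i, 1 ≤ i → i + 1 ≤ n - 1 → E i * T (i + 1) * E i = r • E i
  ETE₂ : ∀ i, 1 ≤ i → i + 1 ≤ n - 1 → E (i + 1) * T i * E (i + 1) = r • E (i + 1)
  Tw_one : Tw 1 = 1
  Tw_s : ∀ i, 1 ≤ i → i ≤ n - 1 → Tw (sGen n i) = T i
  Tw_mul : ∀ u v : Equiv.Perm (Fin n), len (u * v) = len u + len v →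
    Tw (u * v) = Tw u * Tw v

/-- The scalars `a_f` defined by `a_0 = 1` and `a_i = a_{i-1} · Σ_{k=0}^{i-1} q^{2k}`. -/
noncomputable def aseq (q : F) : ℕ → F
  | 0 => 1
  | (i + 1) => aseq q i * (∑ k ∈ Finset.range (i + 1), q ^ (2 * k))


/-- The scalars `c_f` defined by `c_0 = 1` and
`c_f = -((q^{4f-3} - q^{2f-3})/(r q^{2n-2f-2} - q⁻¹)) · c_{f-1}`. -/
noncomputable def cseq (q r : F) (n : ℕ) : ℕ → F
  | 0 => 1
  | (f + 1) =>
      -((q ^ (4 * ((f : ℤ) + 1) - 3) - q ^ (2 * ((f : ℤ) + 1) - 3)) /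
          (r * q ^ (2 * (n : ℤ) - 2 * ((f : ℤ) + 1) - 2) - q⁻¹)) * cseq q r n f

/-- The scalars `č_f` defined by `č_0 = 1` and
`č_f = (q^{3-4f}(1 - q^{2f})/(q + r q^{2+2f-2n})) · č_{f-1}` (with integer exponents). -/
noncomputable def ccseq (q r : F) (n : ℕ) : ℕ → F
  | 0 => 1
  | (f + 1) =>
      (q ^ ((3 : ℤ) - 4 * ((f : ℤ) + 1)) * (1 - q ^ (2 * (f + 1))) /
          (q + r * q ^ ((2 : ℤ) + 2 * ((f : ℤ) + 1) - 2 * (n : ℤ)))) * ccseq q r n f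

/-- The element `x_f = (H_f⁻¹)^ · Ŝ_{{2f+1,…,n}} · Ê_f · Ĥ_f` of the BMW algebra. -/
noncomputable def xEl {F : Type*} [Field F] {A : Type*} [Ring A] [Algebra F A]
    {n : ℕ} {q r : F} (D : BMWData F A n q r) (f : ℕ) : A :=
  hat q D.Tw ((Hset n f).image (fun d => d⁻¹)) * hat q D.Tw (fixSet n (2 * f)) *
    Ehat D.E f * hat q D.Tw (Hset n f)

/-- The element `x̌_f = (H_f⁻¹)ˇ · Š_{{2f+1,…,n}} · Ê_f · Ȟ_f` of the BMW algebra,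
where `ˇ` is formed with `-q⁻¹` in place of `q`. -/
noncomputable def xElCheck {F : Type*} [Field F] {A : Type*} [Ring A] [Algebra F A]
    {n : ℕ} {q r : F} (D : BMWData F A n q r) (f : ℕ) : A :=
  hat (-q⁻¹) D.Tw ((Hset n f).image (fun d => d⁻¹)) * hat (-q⁻¹) D.Tw (fixSet n (2 * f)) *
    Ehat D.E f * hat (-q⁻¹) D.Tw (Hset n f)

end Algebra

lemma perm_inv_apply {α : Type*} (d : Equiv.Perm α) (x : α) : d⁻¹ (d x) = x :=
  Equiv.symm_apply_apply d x

lemma perm_apply_inv {α : Type*} (d : Equiv.Perm α) (x : α) : d (d⁻¹ x) = x :=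
  Equiv.apply_symm_apply d x

section PositionImages

variable {n : ℕ}

lemma pimg_eq (d : Equiv.Perm (Fin n)) {i : ℕ} (h : i - 1 < n) :
    pimg d i = (d⁻¹ ⟨i - 1, h⟩ : Fin n) + 1 := by
  simp [pimg, h]

lemma pimg_val_succ (d : Equiv.Perm (Fin n)) (x : Fin n) :
    pimg d (x + 1) = (d⁻¹ x : Fin n) + 1 := by
  rw [pimg_eq d (by simp)]; simp

lemma one_le_pimg (d : Equiv.Perm (Fin n)) {i : ℕ} (h1 : 1 ≤ i) (hn : i ≤ n) :
    1 ≤ pimg d i := by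
  rw [pimg_eq d (by omega)]; omega

lemma pimg_le (d : Equiv.Perm (Fin n)) {i : ℕ} (h1 : 1 ≤ i) (hn : i ≤ n) :
    pimg d i ≤ n := by
  rw [pimg_eq d (by omega)]; omega

lemma pimg_one {i : ℕ} (h1 : 1 ≤ i) (hn : i ≤ n) :
    pimg (1 : Equiv.Perm (Fin n)) i = i := by
  rw [pimg_eq _ (by omega)]; simp; omega

lemma pimg_mul (a b : Equiv.Perm (Fin n)) {i : ℕ} (h1 : 1 ≤ i) (hn : i ≤ n) :
    pimg (a * b) i = pimg b (pimg a i) := by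
  obtain ⟨x, rfl⟩ : ∃ x : Fin n, i = x + 1 := ⟨⟨i - 1, by omega⟩, by simp; omega⟩
  simp only [pimg_val_succ, mul_inv_rev, Equiv.Perm.mul_apply]

lemma pimg_inv_pimg (d : Equiv.Perm (Fin n)) {i : ℕ} (h1 : 1 ≤ i) (hn : i ≤ n) :
    pimg d⁻¹ (pimg d i) = i := by
  rw [← pimg_mul _ _ h1 hn, mul_inv_cancel, pimg_one h1 hn]

lemma pimg_pimg_inv (d : Equiv.Perm (Fin n)) {i : ℕ} (h1 : 1 ≤ i) (hn : i ≤ n) :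
    pimg d (pimg d⁻¹ i) = i := by
  rw [← pimg_mul _ _ h1 hn, inv_mul_cancel, pimg_one h1 hn]

lemma pimg_inj (d : Equiv.Perm (Fin n)) {i j : ℕ} (hi : 1 ≤ i) (hi' : i ≤ n)
    (hj : 1 ≤ j) (hj' : j ≤ n) (h : pimg d i = pimg d j) : i = j := by
  rw [← pimg_inv_pimg d hi hi', h, pimg_inv_pimg d hj hj']

lemma perm_ext_pimg {a b : Equiv.Perm (Fin n)}
    (h : ∀ i, 1 ≤ i → i ≤ n → pimg a i = pimg b i) : a = b := by
  apply inv_injective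
  ext x
  have := h (x + 1) (by omega) (by omega)
  rw [pimg_val_succ, pimg_val_succ] at this
  omega

lemma exists_perm_pimg_eq (g : ℕ → ℕ)
    (hg : ∀ i, 1 ≤ i → i ≤ n → 1 ≤ g i ∧ g i ≤ n)
    (hinj : ∀ i j, 1 ≤ i → i ≤ n → 1 ≤ j → j ≤ n → g i = g j → i = j) :
    ∃ d : Equiv.Perm (Fin n), ∀ i, 1 ≤ i → i ≤ n → pimg d i = g i := by
  let φ : Fin n → Fin n := fun x =>
    ⟨g (x + 1) - 1, by have := hg (x + 1) (by omega) (by omega); omega⟩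
  have hφ : Function.Injective φ := by
    intro x y hxy
    have h := Fin.val_eq_of_eq hxy
    simp only [φ] at h
    have hx := hg (x + 1) (by omega) (by omega)
    have hy := hg (y + 1) (by omega) (by omega)
    have := hinj (x + 1) (y + 1) (by omega) (by omega) (by omega) (by omega) (by omega)
    omega
  refine ⟨(Equiv.ofBijective φ (Finite.injective_iff_bijective.1 hφ))⁻¹, fun i h1 hn => ?_⟩
  rw [pimg_eq _ (by omega)]
  have := hg i h1 hn
  have hi : i - 1 + 1 = i := by omega
  simp only [inv_inv, Equiv.ofBijective_apply, φ, hi]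
  omega

lemma pimg_sGen {k i : ℕ} (hk : 1 ≤ k) (hkn : k < n) (h1 : 1 ≤ i) (hn : i ≤ n) :
    pimg (sGen n k) i = if i = k then k + 1 else if i = k + 1 then k else i := by
  rw [pimg_eq _ (by omega), sGen, dif_pos ⟨hk, hkn⟩, Equiv.swap_inv, Equiv.swap_apply_def]
  simp only [Fin.mk.injEq]
  split_ifs <;> simp only [] <;> omega

lemma pimg_bbs {k i : ℕ} (hk : 1 ≤ k) (hkn : 2 * k + 2 ≤ n) (h1 : 1 ≤ i) (hn : i ≤ n) :
    pimg (bbs n k) i =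
      if i = 2 * k - 1 ∨ i = 2 * k then i + 2
      else if i = 2 * k + 1 ∨ i = 2 * k + 2 then i - 2 else i := by
  rw [bbs, pimg_mul _ _ h1 hn, pimg_mul _ _ h1 hn, pimg_mul _ _ h1 hn,
    pimg_sGen (by omega) (by omega) h1 hn]
  rw [pimg_sGen (k := 2 * k - 1) (by omega) (by omega) (by split_ifs <;> omega)
    (by split_ifs <;> omega)]
  rw [pimg_sGen (k := 2 * k + 1) (by omega) (by omega) (by split_ifs <;> omega)
    (by split_ifs <;> omega)]
  rw [pimg_sGen (k := 2 * k) (by omega) (by omega) (by split_ifs <;> omega)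
    (by split_ifs <;> omega)]
  split_ifs <;> omega

lemma pimg_bbs_cycle {f m i : ℕ} (hm : m + 2 ≤ f) (h1 : 1 ≤ i) (hn : i ≤ 2 * f) :
    pimg (bbs (2 * f) 1 * ((List.range m).map (fun j => bbs (2 * f) (j + 2))).prod) i =
      if i ≤ 2 then i + 2 * (m + 1) else if i ≤ 2 * (m + 1) + 2 then i - 2 else i := by
  induction m with
  | zero =>
    simp only [List.range_zero, List.map_nil, List.prod_nil, mul_one]
    rw [pimg_bbs (by omega) (by omega) h1 hn]
    split_ifs <;> omega
  | succ m ih =>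
    rw [List.range_succ, List.map_append, List.prod_append, ← mul_assoc, pimg_mul _ _ h1 hn,
      ih (by omega)]
    simp only [List.map_cons, List.map_nil, List.prod_cons, List.prod_nil, mul_one]
    rw [pimg_bbs (by omega) (by omega) (by split_ifs <;> omega) (by split_ifs <;> omega)]
    split_ifs <;> omega

lemma pimg_shiftEmb_of_mem {k m i : ℕ} (h : k + m ≤ n) (w : Equiv.Perm (Fin m))
    (h1 : k < i) (h2 : i ≤ k + m) :
    pimg (shiftEmb n k m w) i = k + pimg w (i - k) := by
  rw [pimg_eq _ (by omega), pimg_eq _ (by omega), shiftEmb, dif_pos h,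
    Equiv.Perm.extendDomain_inv]
  have e : (⟨i - 1, by omega⟩ : Fin n) =
      ((shiftEquiv n k m h ⟨i - k - 1, by omega⟩ : {a : Fin n // _}) : Fin n) := by
    apply Fin.ext
    simp only [shiftEquiv, Equiv.coe_fn_mk]
    omega
  rw [e, Equiv.Perm.extendDomain_apply_image]
  simp only [shiftEquiv, Equiv.coe_fn_mk]
  omega

lemma pimg_shiftEmb_of_not_mem {k m i : ℕ} (h : k + m ≤ n) (w : Equiv.Perm (Fin m))
    (h1 : 1 ≤ i) (hn : i ≤ n) (h2 : i ≤ k ∨ k + m < i) :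
    pimg (shiftEmb n k m w) i = i := by
  rw [pimg_eq _ (by omega), shiftEmb, dif_pos h, Equiv.Perm.extendDomain_inv,
    Equiv.Perm.extendDomain_apply_not_subtype]
  · simp only []; omega
  · simp only []; omega

lemma exists_shiftEmb_eq {k m : ℕ} (h : k + m ≤ n) (w : Equiv.Perm (Fin n))
    (hw : ∀ i, 1 ≤ i → i ≤ n → (i ≤ k ∨ k + m < i) → pimg w i = i) :
    ∃ v, shiftEmb n k m v = w := by
  have key : ∀ i, k < i → i ≤ k + m → k < pimg w i ∧ pimg w i ≤ k + m := by
    intro i hi hi'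
    by_contra hc
    have h1 := one_le_pimg w (i := i) (by omega) (by omega)
    have h2 := pimg_le w (i := i) (by omega) (by omega)
    have h3 := pimg_inj w h1 h2 (by omega) (by omega) (hw _ h1 h2 (by omega))
    omega
  obtain ⟨v, hv⟩ := exists_perm_pimg_eq (n := m) (fun i => pimg w (i + k) - k)
    (by intro i hi hi'; have := key (i + k) (by omega) (by omega); omega)
    (by
      intro i j hi hi' hj hj' hij
      have h1 := key (i + k) (by omega) (by omega)
      have h2 := key (j + k) (by omega) (by omega)
      have := pimg_inj w (i := i + k) (j := j + k) (by omega) (by omega) (by omega) (by omega)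
        (by omega)
      omega)
  refine ⟨v, perm_ext_pimg fun i h1 hn => ?_⟩
  by_cases hi : i ≤ k ∨ k + m < i
  · rw [pimg_shiftEmb_of_not_mem h v h1 hn hi, hw i h1 hn hi]
  · have := key i (by omega) (by omega)
    rw [pimg_shiftEmb_of_mem h v (by omega) (by omega), hv _ (by omega) (by omega),
      show i - k + k = i by omega]
    omega

end PositionImages

section Blocks

variable {n : ℕ} {β : Fin n → ℕ}

lemma len_mul_of_blocks (hβ : Monotone β) {u c : Equiv.Perm (Fin n)}
    (hu : ∀ x, β (u x) = β x)
    (hc : ∀ x y, β x = β y → x < y → c⁻¹ x < c⁻¹ y) :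
    len (u * c) = len u + len c := by
  classical
  have lt_of : ∀ x y, β x < β y → x < y := fun x y h =>
    lt_of_not_ge fun h' => absurd (hβ h') (by omega)
  have hc' : ∀ p q, β (c p) = β (c q) → (c p < c q ↔ p < q) := by
    intro p q h
    constructor
    · intro h'; simpa using hc _ _ h h'
    · intro h'
      by_contra h''
      rcases lt_or_eq_of_le (not_lt.1 h'') with h3 | h3
      · have := hc _ _ h.symm h3
        simp only [perm_inv_apply] at this
        exact absurd h' this.asymm
      · rw [c.injective h3] at h'; exact lt_irrefl _ h'
  have hsplit : (univ.filter fun p : Fin n × Fin n => p.1 < p.2 ∧ (u * c) p.2 < (u * c) p.1) =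
      (univ.filter fun p : Fin n × Fin n => p.1 < p.2 ∧ u p.2 < u p.1).map
        (Equiv.prodCongr c⁻¹ c⁻¹).toEmbedding ∪
      univ.filter fun p : Fin n × Fin n => p.1 < p.2 ∧ c p.2 < c p.1 := by
    ext ⟨p, q⟩
    simp only [mem_filter, mem_univ, true_and, mem_union, mem_map_equiv,
      Equiv.prodCongr_symm, Equiv.prodCongr_apply, Prod.map]
    change (p < q ∧ u (c q) < u (c p)) ↔ (c p < c q ∧ u (c q) < u (c p)) ∨ _
    by_cases hb : β (c p) = β (c q)
    · have h1 := hc' p q hb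
      have h2 := hc' q p hb.symm
      rw [h1, h2]
      constructor
      · tauto
      · rintro (h | h)
        · exact h
        · exact absurd h.1 h.2.asymm
    · have h1 : u (c q) < u (c p) ↔ c q < c p := by
        rcases lt_or_gt_of_ne hb with h | h
        · have h3 := lt_of _ _ h
          have h4 := lt_of (u (c p)) (u (c q)) (by rwa [hu, hu])
          exact iff_of_false h4.asymm h3.asymm
        · have h3 := lt_of _ _ h
          have h4 := lt_of (u (c q)) (u (c p)) (by rwa [hu, hu])
          exact iff_of_true h4 h3
      rw [h1]
      constructor
      · exact Or.inr
      · rintro (h | h)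
        · exact absurd h.1 h.2.asymm
        · exact h
  rw [len, len, len, hsplit, card_union_of_disjoint, card_map]
  rw [Finset.disjoint_left]
  rintro ⟨p, q⟩ h1 h2
  simp only [mem_filter, mem_univ, true_and, mem_map_equiv,
    Equiv.prodCongr_symm, Equiv.prodCongr_apply, Prod.map] at h1 h2
  change c p < c q ∧ _ at h1
  exact h1.1.asymm h2.2

lemma inv_lt_inv_of_minimal (hβ : Monotone β) {d : Equiv.Perm (Fin n)}
    (h : ∀ u : Equiv.Perm (Fin n), (∀ x, β (u x) = β x) → len d ≤ len (u * d)) :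
    ∀ x y, β x = β y → x < y → d⁻¹ x < d⁻¹ y := by
  classical
  have adj : ∀ x y : Fin n, β x = β y → (y : ℕ) = x + 1 → d⁻¹ x < d⁻¹ y := by
    intro x y hb hxy
    by_contra hlt
    have hne : d⁻¹ x ≠ d⁻¹ y := fun h => by have := d⁻¹.injective h; subst this; omega
    have hlt' : d⁻¹ y < d⁻¹ x := lt_of_le_of_ne (not_lt.1 hlt) hne.symm
    refine absurd (h (Equiv.swap x y) ?_) (not_le.2 ?_)
    · intro z
      rw [Equiv.swap_apply_def]
      split_ifs with h1 h2
      · rw [h1, hb]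
      · rw [h2, hb]
      · rfl
    · apply card_lt_card
      rw [Finset.ssubset_iff_subset_ne, ne_eq, Finset.Subset.antisymm_iff, not_and]
      refine ⟨?_, fun _ hs => ?_⟩
      · rintro ⟨p, q⟩
        simp only [mem_filter, mem_univ, true_and]
        simp only [Equiv.Perm.mul_apply]
        rintro ⟨h1, h2⟩
        refine ⟨h1, ?_⟩
        have hp : ∀ z, d z = x → z = d⁻¹ x := fun z hz => by rw [← hz, perm_inv_apply]
        have hq : ∀ z, d z = y → z = d⁻¹ y := fun z hz => by rw [← hz, perm_inv_apply]
        rw [Equiv.swap_apply_def, Equiv.swap_apply_def] at h2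
        have k1 := hp p; have k2 := hp q; have k3 := hq p; have k4 := hq q
        simp only [Fin.ext_iff, Fin.lt_def] at *
        split_ifs at h2 <;> grind
      · have := hs (mem_filter.2 ⟨mem_univ (d⁻¹ y, d⁻¹ x), hlt', by
          rw [perm_apply_inv, perm_apply_inv, Fin.lt_def]; omega⟩)
        simp only [mem_filter, mem_univ, true_and] at this
        simp only [Equiv.Perm.mul_apply, perm_apply_inv, Equiv.swap_apply_left,
          Equiv.swap_apply_right, Fin.lt_def] at this
        omega
  have key : ∀ k : ℕ, ∀ x y : Fin n, β x = β y → (y : ℕ) = x + 1 + k → d⁻¹ x < d⁻¹ y := by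
    intro k
    induction k with
    | zero => exact adj
    | succ k ih =>
      intro x y hb hxy
      let z : Fin n := ⟨x + 1 + k, by omega⟩
      have h1 : β x ≤ β z := hβ (by simp only [z, Fin.le_def]; omega)
      have h2 : β z ≤ β y := hβ (by simp only [z, Fin.le_def]; omega)
      exact (ih x z (by omega) rfl).trans (adj z y (by omega) (by simp only [z]; omega))
  intro x y hb hxy
  exact key (y - x - 1) x y hb (by have := Fin.lt_def.1 hxy; omega)

lemma exists_block_factorization (hβ : Monotone β) (d : Equiv.Perm (Fin n)) :
    ∃ u c : Equiv.Perm (Fin n), d = u * c ∧ (∀ x, β (u x) = β x) ∧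
      ∀ x y, β x = β y → x < y → c⁻¹ x < c⁻¹ y := by
  classical
  obtain ⟨v, hv, hmin⟩ := exists_min_image
    (univ.filter fun u : Equiv.Perm (Fin n) => ∀ x, β (u x) = β x)
    (fun u => len (u * d)) ⟨1, by simp⟩
  simp only [mem_filter, mem_univ, true_and] at hv hmin
  refine ⟨v⁻¹, v * d, by group, fun x => ?_, inv_lt_inv_of_minimal hβ fun u hu => ?_⟩
  · have := hv (v⁻¹ x)
    rw [perm_apply_inv] at this
    exact this.symm
  · rw [← mul_assoc]
    exact hmin _ fun x => by rw [Equiv.Perm.mul_apply, hu, hv]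

lemma block_factorization_unique (hβ : Monotone β) {u c u' c' : Equiv.Perm (Fin n)}
    (h : u * c = u' * c') (hu : ∀ x, β (u x) = β x) (hu' : ∀ x, β (u' x) = β x)
    (hc : ∀ x y, β x = β y → x < y → c⁻¹ x < c⁻¹ y)
    (hc' : ∀ x y, β x = β y → x < y → c'⁻¹ x < c'⁻¹ y) : u = u' ∧ c = c' := by
  have h1 := len_mul_of_blocks hβ (u := u'⁻¹ * u) (c := c) (fun x => by
    have := hu' (u'⁻¹ (u x))
    rw [perm_apply_inv] at this
    rw [Equiv.Perm.mul_apply, ← this, hu]) hc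
  have h2 := len_mul_of_blocks hβ (u := u⁻¹ * u') (c := c') (fun x => by
    have := hu (u⁻¹ (u' x))
    rw [perm_apply_inv] at this
    rw [Equiv.Perm.mul_apply, ← this, hu']) hc'
  rw [mul_assoc, h, inv_mul_cancel_left] at h1
  rw [mul_assoc, ← h, inv_mul_cancel_left] at h2
  have h0 : len (u'⁻¹ * u) = 0 := by omega
  have hmono : StrictMono (u'⁻¹ * u) := by
    intro x y hxy
    rw [len, card_eq_zero, filter_eq_empty_iff] at h0
    have := h0 (mem_univ (x, y))
    exact lt_of_le_of_ne (by simpa [hxy] using this) ((u'⁻¹ * u).injective.ne hxy.ne)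
  have hone : u'⁻¹ * u = 1 := by
    have := Subsingleton.elim (hmono.orderIsoOfSurjective _ (u'⁻¹ * u).surjective)
      (OrderIso.refl (Fin n))
    ext x
    exact congrArg (fun g : Fin n ≃o Fin n => (g x : ℕ)) this
  have huu : u = u' := (inv_mul_eq_one.1 hone).symm
  subst huu
  exact ⟨rfl, mul_left_cancel h⟩

lemma blockOf_monotone (μ : List ℕ) : Monotone (blockOf μ) := by
  intro k l hkl
  apply List.Sublist.length_le
  apply List.monotone_filter_right
  intro j hj
  simp only [decide_eq_true_eq] at hj ⊢
  omega

lemma mem_Dset_iff (μ : List ℕ) (d : Equiv.Perm (Fin n)) :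
    d ∈ Dset n μ ↔
      ∀ x y : Fin n, blockOf μ x = blockOf μ y → x < y → d⁻¹ x < d⁻¹ y := by
  have hβ : Monotone fun x : Fin n => blockOf μ x := fun x y h => blockOf_monotone μ h
  simp only [Dset, youngSet, mem_filter, mem_univ, true_and]
  constructor
  · exact inv_lt_inv_of_minimal hβ
  · intro h u hu
    rw [len_mul_of_blocks hβ hu h]
    omega

lemma forall_inv_lt_inv_iff (d : Equiv.Perm (Fin n)) (b : ℕ → ℕ) :
    (∀ x y : Fin n, b x = b y → x < y → d⁻¹ x < d⁻¹ y) ↔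
      ∀ i j, 1 ≤ i → i < j → j ≤ n → b (i - 1) = b (j - 1) → pimg d i < pimg d j := by
  constructor
  · intro h i j h1 hij hj hb
    rw [pimg_eq d (by omega), pimg_eq d (by omega)]
    have := h ⟨i - 1, by omega⟩ ⟨j - 1, by omega⟩ hb (by simp only [Fin.lt_def]; omega)
    omega
  · intro h x y hb hxy
    have := h (x + 1) (y + 1) (by omega) (by omega) (by omega) (by simpa using hb)
    rw [pimg_val_succ, pimg_val_succ] at this
    omega

lemma blockOf_replicate_two {f k : ℕ} (hk : k < 2 * f) :
    blockOf (List.replicate f 2) k = k / 2 := by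
  have : ((List.range f).filter fun j => decide (((List.replicate f 2).take (j + 1)).sum ≤ k)) =
      List.range (k / 2) := by
    have h : f = k / 2 + (f - k / 2) := by omega
    rw [h, List.range_add, List.filter_append, ← h, List.filter_eq_self.2, List.filter_eq_nil_iff.2,
      List.append_nil]
    · intro a ha
      simp only [List.mem_map, List.mem_range] at ha
      obtain ⟨b, hb, rfl⟩ := ha
      simp [List.take_replicate]; omega
    · intro a ha
      simp only [List.mem_range] at ha
      simp [List.take_replicate]; omega
  rw [blockOf, List.length_replicate, this, List.length_range]

lemma blockOf_pair {p q k : ℕ} (hk : k < p + q) :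
    blockOf [p, q] k = if k < p then 0 else 1 := by
  have h2 : ¬ (p + q ≤ k) := by omega
  by_cases h : p ≤ k
  · simp [blockOf, List.range_succ, h, h2]
  · simp [blockOf, List.range_succ, h, h2]

end Blocks

section Cut

variable {n m : ℕ}

lemma pimg_le_of_fix_gt {a : Equiv.Perm (Fin n)} (ha : ∀ i, m < i → i ≤ n → pimg a i = i)
    {i : ℕ} (h1 : 1 ≤ i) (hn : i ≤ n) (hi : i ≤ m) : pimg a i ≤ m := by
  by_contra hc
  have h2 := pimg_le a h1 hn
  have := pimg_inj a (by omega) h2 h1 hn (ha _ (by omega) h2)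
  omega

lemma lt_pimg_of_fix_le {b : Equiv.Perm (Fin n)} (hb : ∀ i, 1 ≤ i → i ≤ m → pimg b i = i)
    {i : ℕ} (hn : i ≤ n) (hi : m < i) : m < pimg b i := by
  by_contra hc
  have h2 := one_le_pimg b (i := i) (by omega) hn
  have h3 := pimg_le b (i := i) (by omega) hn
  have := pimg_inj b h2 h3 (by omega) hn (hb _ h2 (by omega))
  omega

lemma pimg_mul_mul_of_le {a b : Equiv.Perm (Fin n)} (c : Equiv.Perm (Fin n))
    (ha : ∀ i, m < i → i ≤ n → pimg a i = i) (hb : ∀ i, 1 ≤ i → i ≤ m → pimg b i = i)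
    {i : ℕ} (h1 : 1 ≤ i) (hn : i ≤ n) (hi : i ≤ m) :
    pimg (a * b * c) i = pimg c (pimg a i) := by
  rw [pimg_mul _ _ h1 hn, pimg_mul _ _ h1 hn,
    hb _ (one_le_pimg a h1 hn) (pimg_le_of_fix_gt ha h1 hn hi)]

lemma pimg_mul_mul_of_gt {a : Equiv.Perm (Fin n)} (b c : Equiv.Perm (Fin n))
    (ha : ∀ i, m < i → i ≤ n → pimg a i = i) {i : ℕ} (hn : i ≤ n) (hi : m < i) :
    pimg (a * b * c) i = pimg c (pimg b i) := by
  rw [pimg_mul _ _ (by omega) hn, pimg_mul _ _ (by omega) hn, ha i hi hn]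

lemma forall_block_apply_iff (u : Equiv.Perm (Fin n)) (b : ℕ → ℕ) :
    (∀ x : Fin n, b (u x) = b x) ↔
      ∀ i, 1 ≤ i → i ≤ n → b (pimg u i - 1) = b (i - 1) := by
  constructor
  · intro h i h1 hn
    rw [pimg_eq u (by omega), Nat.add_sub_cancel, ← h, perm_apply_inv]
  · intro h x
    have := h ((u x : ℕ) + 1) (by omega) (by omega)
    rw [pimg_val_succ, perm_inv_apply] at this
    simpa using this.symm

lemma monotone_cut (m n : ℕ) : Monotone fun x : Fin n => if (x : ℕ) < m then 0 else 1 := by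
  intro x y h
  have := Fin.le_def.1 h
  simp only []
  split_ifs <;> omega

lemma cut_incr_iff (c : Equiv.Perm (Fin n)) :
    (∀ x y : Fin n, (if (x : ℕ) < m then 0 else 1) = (if (y : ℕ) < m then 0 else 1) →
        x < y → c⁻¹ x < c⁻¹ y) ↔
      ∀ i j, 1 ≤ i → i < j → j ≤ n → (j ≤ m ∨ m < i) → pimg c i < pimg c j := by
  rw [forall_inv_lt_inv_iff c fun k => if k < m then 0 else 1]
  refine forall₅_congr fun i j h1 hij hj => ?_
  have : ((if i - 1 < m then 0 else 1) = if j - 1 < m then 0 else 1) ↔ (j ≤ m ∨ m < i) := by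
    split_ifs <;> simp <;> omega
  simp only [this]

lemma cut_mul_preserves {a b : Equiv.Perm (Fin n)}
    (ha : ∀ i, m < i → i ≤ n → pimg a i = i) (hb : ∀ i, 1 ≤ i → i ≤ m → pimg b i = i)
    (x : Fin n) :
    (if ((a * b) x : ℕ) < m then 0 else 1) = if (x : ℕ) < m then 0 else 1 := by
  revert x
  rw [forall_block_apply_iff (a * b) fun k => if k < m then 0 else 1]
  intro i h1 hn
  by_cases hi : i ≤ m
  · have h2 := pimg_mul_mul_of_le 1 ha hb h1 hn hi
    have h3 := pimg_le_of_fix_gt ha h1 hn hi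
    have h4 := one_le_pimg a h1 hn
    rw [mul_one, pimg_one h4 (pimg_le a h1 hn)] at h2
    rw [h2, if_pos (by omega), if_pos (by omega)]
  · have h2 := pimg_mul_mul_of_gt b 1 ha hn (by omega)
    have h3 := lt_pimg_of_fix_le hb hn (by omega)
    rw [mul_one, pimg_one (by omega) (pimg_le b h1 hn)] at h2
    rw [h2, if_neg (by omega), if_neg (by omega)]

lemma len_mul_mul_of_cut {a b c : Equiv.Perm (Fin n)}
    (ha : ∀ i, m < i → i ≤ n → pimg a i = i) (hb : ∀ i, 1 ≤ i → i ≤ m → pimg b i = i)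
    (hc : ∀ i j, 1 ≤ i → i < j → j ≤ n → (j ≤ m ∨ m < i) → pimg c i < pimg c j) :
    len (a * b * c) = len a + len b + len c := by
  rw [len_mul_of_blocks (monotone_cut m n) (cut_mul_preserves ha hb) ((cut_incr_iff c).2 hc)]
  congr 1
  apply len_mul_of_blocks (β := fun x : Fin n => if (x : ℕ) < m then 0 else (x : ℕ))
  · intro x y h
    have := Fin.le_def.1 h
    simp only []
    split_ifs <;> omega
  · rw [forall_block_apply_iff a fun k => if k < m then 0 else k]
    intro i h1 hn
    by_cases hi : i ≤ m
    · have h3 := pimg_le_of_fix_gt ha h1 hn hi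
      have h4 := one_le_pimg a h1 hn
      rw [if_pos (by omega), if_pos (by omega)]
    · rw [ha i (by omega) hn]
  · rw [forall_inv_lt_inv_iff b fun k => if k < m then 0 else k]
    intro i j h1 hij hj h
    have hjm : j ≤ m := by
      split_ifs at h <;> omega
    rwa [hb i h1 (by omega), hb j (by omega) hjm]

lemma exists_cut_factorization (m : ℕ) (d : Equiv.Perm (Fin n)) :
    ∃ a b c : Equiv.Perm (Fin n), d = a * b * c ∧
      (∀ i, m < i → i ≤ n → pimg a i = i) ∧ (∀ i, 1 ≤ i → i ≤ m → i ≤ n → pimg b i = i) ∧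
      ∀ i j, 1 ≤ i → i < j → j ≤ n → (j ≤ m ∨ m < i) → pimg c i < pimg c j := by
  obtain ⟨u, c, rfl, hu, hc⟩ := exists_block_factorization (monotone_cut m n) d
  rw [cut_incr_iff] at hc
  rw [forall_block_apply_iff u fun k => if k < m then 0 else 1] at hu
  have hum : ∀ i, 1 ≤ i → i ≤ n → (pimg u i ≤ m ↔ i ≤ m) := by
    intro i h1 hn
    have := hu i h1 hn
    have h2 := one_le_pimg u h1 hn
    split_ifs at this <;> omega
  obtain ⟨a, ha⟩ := exists_perm_pimg_eq (n := n) (fun i => if i ≤ m then pimg u i else i)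
    (by
      intro i h1 hn
      split_ifs
      · exact ⟨one_le_pimg u h1 hn, pimg_le u h1 hn⟩
      · omega)
    (by
      intro i j hi hi' hj hj' h
      have h1 := hum i hi hi'
      have h2 := hum j hj hj'
      split_ifs at h
      · exact pimg_inj u hi hi' hj hj' h
      all_goals omega)
  refine ⟨a, a⁻¹ * u, c, by group, fun i hi hn => ?_, fun i h1 hi hn => ?_, hc⟩
  · rw [ha i (by omega) hn, if_neg (by omega)]
  · have h3 := one_le_pimg a⁻¹ h1 hn
    have h4 := pimg_le a⁻¹ h1 hn
    have h2 := ha (pimg a⁻¹ i) h3 h4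
    rw [pimg_pimg_inv a h1 hn] at h2
    rw [pimg_mul _ _ h1 hn]
    split_ifs at h2
    · exact h2.symm
    · omega

lemma cut_factorization_unique {a b c a' b' c' : Equiv.Perm (Fin n)}
    (ha : ∀ i, m < i → i ≤ n → pimg a i = i) (hb : ∀ i, 1 ≤ i → i ≤ m → pimg b i = i)
    (hc : ∀ i j, 1 ≤ i → i < j → j ≤ n → (j ≤ m ∨ m < i) → pimg c i < pimg c j)
    (ha' : ∀ i, m < i → i ≤ n → pimg a' i = i) (hb' : ∀ i, 1 ≤ i → i ≤ m → pimg b' i = i)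
    (hc' : ∀ i j, 1 ≤ i → i < j → j ≤ n → (j ≤ m ∨ m < i) → pimg c' i < pimg c' j)
    (h : a * b * c = a' * b' * c') : a = a' ∧ b = b' ∧ c = c' := by
  obtain ⟨hab, hcc⟩ := block_factorization_unique (monotone_cut m n) h
    (cut_mul_preserves ha hb) (cut_mul_preserves ha' hb')
    ((cut_incr_iff c).2 hc) ((cut_incr_iff c').2 hc')
  have haa : a = a' := by
    refine perm_ext_pimg fun i h1 hn => ?_
    by_cases hi : i ≤ m
    · have h2 := pimg_mul_mul_of_le 1 ha hb h1 hn hi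
      have h3 := pimg_mul_mul_of_le 1 ha' hb' h1 hn hi
      rw [hab, h3, pimg_one (one_le_pimg _ h1 hn) (pimg_le _ h1 hn),
        pimg_one (one_le_pimg _ h1 hn) (pimg_le _ h1 hn)] at h2
      exact h2.symm
    · rw [ha i (by omega) hn, ha' i (by omega) hn]
  subst haa
  exact ⟨rfl, mul_left_cancel hab, hcc⟩

end Cut

section Characterizations

lemma mem_Dset_replicate_two_iff {f : ℕ} (d : Equiv.Perm (Fin (2 * f))) :
    d ∈ Dset (2 * f) (List.replicate f 2) ↔
      ∀ i, 1 ≤ i → i ≤ f → pimg d (2 * i - 1) < pimg d (2 * i) := by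
  rw [mem_Dset_iff, forall_inv_lt_inv_iff d (blockOf (List.replicate f 2))]
  constructor
  · intro h i h1 hi
    apply h _ _ (by omega) (by omega) (by omega)
    rw [blockOf_replicate_two (by omega), blockOf_replicate_two (by omega)]
    omega
  · intro h i j h1 hij hj hb
    rw [blockOf_replicate_two (by omega), blockOf_replicate_two (by omega)] at hb
    have := h (j / 2) (by omega) (by omega)
    rwa [show 2 * (j / 2) = j by omega, show j - 1 = i by omega] at this

lemma mem_Dset_pair_iff {n p q : ℕ} (hn : n = p + q) (d : Equiv.Perm (Fin n)) :
    d ∈ Dset n [p, q] ↔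
      ∀ i j, 1 ≤ i → i < j → j ≤ n → (j ≤ p ∨ p < i) → pimg d i < pimg d j := by
  rw [mem_Dset_iff, ← cut_incr_iff]
  refine forall₂_congr fun x y => ?_
  rw [blockOf_pair (by omega), blockOf_pair (by omega)]

lemma mem_Hset_iff {n f : ℕ} (hn : n = 2 * f) (d : Equiv.Perm (Fin n)) :
    d ∈ Hset n f ↔
      (∀ i, 1 ≤ i → i < f → pimg d (2 * i - 1) < pimg d (2 * i + 1)) ∧
      ∀ i, 1 ≤ i → i ≤ f → pimg d (2 * i - 1) < pimg d (2 * i) := by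
  simp only [Hset, mem_filter, mem_univ, true_and, mem_Icc]
  constructor
  · rintro ⟨h1, h2, -⟩
    exact ⟨fun i hi hi' => h1 i (by omega), fun i hi hi' => h2 i (by omega)⟩
  · rintro ⟨h1, h2⟩
    exact ⟨fun i hi => h1 i (by omega) (by omega), fun i hi => h2 i (by omega) (by omega),
      fun j hj => by omega⟩

lemma odd_pimg_lt {n k f : ℕ} {d : Equiv.Perm (Fin n)}
    (h : ∀ i, k ≤ i → i < f → pimg d (2 * i - 1) < pimg d (2 * i + 1))
    {i j : ℕ} (hi : k ≤ i) (hij : i < j) (hj : j ≤ f) :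
    pimg d (2 * i - 1) < pimg d (2 * j - 1) := by
  induction j, hij using Nat.le_induction with
  | base => exact h i hi (by omega)
  | succ j hij ih =>
    have := h j (by omega) (by omega)
    exact (ih (by omega)).trans this

/-- Every pair `((2i-1)d, (2i)d)` is increasing, the first entries of the pairs `2, …, f`
increase, and the first pair starts above the second one. -/
def IsSwappedSorted (f : ℕ) (d : Equiv.Perm (Fin (2 * f))) : Prop :=
  (∀ i, 1 ≤ i → i ≤ f → pimg d (2 * i - 1) < pimg d (2 * i)) ∧
  (∀ i, 2 ≤ i → i < f → pimg d (2 * i - 1) < pimg d (2 * i + 1)) ∧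
  pimg d 3 < pimg d 1

lemma mem_filter_Dset_iff {f : ℕ} (hf : 2 ≤ f) (d : Equiv.Perm (Fin (2 * f))) :
    (d ∈ Dset (2 * f) (List.replicate f 2) ∧
      (∀ i ∈ Finset.Icc 1 (f - 2), pimg d (2 * i + 1) < pimg d (2 * i + 3)) ∧
        pimg d 3 < pimg d 1) ↔ IsSwappedSorted f d := by
  rw [mem_Dset_replicate_two_iff, IsSwappedSorted]
  refine and_congr_right fun _ => and_congr_left fun _ => ?_
  simp only [mem_Icc]
  constructor
  · intro h i hi hi'
    have := h (i - 1) (by omega)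
    rwa [show 2 * (i - 1) + 1 = 2 * i - 1 by omega,
      show 2 * (i - 1) + 3 = 2 * i + 1 by omega] at this
  · intro h i hi
    exact h (i + 1) (by omega) (by omega)

lemma mem_bbs_mul_bbD1'_mul_Hset_iff {f : ℕ} (hf : 2 ≤ f) (d : Equiv.Perm (Fin (2 * f))) :
    d ∈ {bbs (2 * f) 1} * bbD1' f * Hset (2 * f) f ↔ IsSwappedSorted f d := by
  simp only [mem_mul, mem_singleton, bbD1', mem_image, mem_Icc]
  constructor
  · rintro ⟨_, ⟨_, rfl, _, ⟨k, hk, rfl⟩, rfl⟩, h, hh, rfl⟩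
    rw [mem_Hset_iff rfl] at hh
    obtain ⟨h1, h2⟩ := hh
    have hp : ∀ i j, 1 ≤ i → i ≤ 2 * f →
        (if i ≤ 2 then i + 2 * k else if i ≤ 2 * k + 2 then i - 2 else i) = j →
        pimg (bbs (2 * f) 1 *
          ((List.range (k - 1)).map (fun j => bbs (2 * f) (j + 2))).prod * h) i = pimg h j := by
      intro i j hi hi' hij
      rw [pimg_mul _ _ hi hi', pimg_bbs_cycle (by omega) hi hi', show k - 1 + 1 = k by omega, hij]
    refine ⟨fun i hi hi' => ?_, fun i hi hi' => ?_, ?_⟩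
    · rcases Nat.lt_or_ge 1 i with h3 | h3
      · rcases Nat.lt_or_ge (k + 1) i with h4 | h4
        · rw [hp _ (2 * i - 1) (by omega) (by omega) (by split_ifs <;> omega),
            hp _ (2 * i) (by omega) (by omega) (by split_ifs <;> omega)]
          exact h2 i hi hi'
        · rw [hp _ (2 * (i - 1) - 1) (by omega) (by omega) (by split_ifs <;> omega),
            hp _ (2 * (i - 1)) (by omega) (by omega) (by split_ifs <;> omega)]
          exact h2 (i - 1) (by omega) (by omega)
      · rw [hp _ (2 * (k + 1) - 1) (by omega) (by omega) (by split_ifs <;> omega),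
          hp _ (2 * (k + 1)) (by omega) (by omega) (by split_ifs <;> omega)]
        exact h2 (k + 1) (by omega) (by omega)
    · rcases Nat.lt_trichotomy i (k + 1) with h3 | h3 | h3
      · rw [hp _ (2 * (i - 1) - 1) (by omega) (by omega) (by split_ifs <;> omega),
          hp _ (2 * (i - 1) + 1) (by omega) (by omega) (by split_ifs <;> omega)]
        exact h1 (i - 1) (by omega) (by omega)
      · rw [hp _ (2 * (i - 1) - 1) (by omega) (by omega) (by split_ifs <;> omega),
          hp _ (2 * (i + 1) - 1) (by omega) (by omega) (by split_ifs <;> omega)]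
        exact odd_pimg_lt h1 (by omega) (by omega) (by omega)
      · rw [hp _ (2 * i - 1) (by omega) (by omega) (by split_ifs <;> omega),
          hp _ (2 * i + 1) (by omega) (by omega) (by split_ifs <;> omega)]
        exact h1 i (by omega) (by omega)
    · rw [hp _ (2 * 1 - 1) (by omega) (by omega) (by split_ifs <;> omega),
        hp _ (2 * (k + 1) - 1) (by omega) (by omega) (by split_ifs <;> omega)]
      exact odd_pimg_lt h1 (by omega) (by omega) (by omega)
  · rintro ⟨h2, h1, h0⟩
    obtain ⟨k, hk, hmax⟩ := exists_max_image
      ((Finset.Icc 1 (f - 1)).filter fun k => pimg d (2 * k + 1) < pimg d 1) id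
      ⟨1, by simp only [mem_filter, mem_Icc]; exact ⟨by omega, h0⟩⟩
    simp only [mem_filter, mem_Icc, id] at hk hmax
    obtain ⟨hk, hkd⟩ := hk
    set g := bbs (2 * f) 1 * ((List.range (k - 1)).map (fun j => bbs (2 * f) (j + 2))).prod
      with hg
    refine ⟨g, ⟨_, rfl, _, ⟨k, hk, rfl⟩, rfl⟩, g⁻¹ * d, ?_, by group⟩
    have hgi : ∀ i, 1 ≤ i → i ≤ 2 * f →
        pimg g i = if i ≤ 2 then i + 2 * k else if i ≤ 2 * k + 2 then i - 2 else i := by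
      intro i hi hi'
      rw [hg, pimg_bbs_cycle (by omega) hi hi', show k - 1 + 1 = k by omega]
    have hp : ∀ i j, 1 ≤ j → j ≤ 2 * f →
        i = (if j ≤ 2 then j + 2 * k else if j ≤ 2 * k + 2 then j - 2 else j) →
        pimg (g⁻¹ * d) i = pimg d j := by
      intro i j hj hj' hij
      rw [← hgi j hj hj'] at hij
      rw [hij, pimg_mul _ _ (one_le_pimg g hj hj') (pimg_le g hj hj'), pimg_inv_pimg g hj hj']
    rw [mem_Hset_iff rfl]
    refine ⟨fun i hi hi' => ?_, fun i hi hi' => ?_⟩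
    · rcases Nat.lt_trichotomy i k with h3 | rfl | h3
      · rw [hp _ (2 * (i + 1) - 1) (by omega) (by omega) (by split_ifs <;> omega),
          hp _ (2 * (i + 1) + 1) (by omega) (by omega) (by split_ifs <;> omega)]
        exact h1 (i + 1) (by omega) (by omega)
      · rw [hp _ (2 * i + 1) (by omega) (by omega) (by split_ifs <;> omega),
          hp _ 1 (by omega) (by omega) (by split_ifs <;> omega)]
        exact hkd
      · rcases Nat.lt_or_ge (k + 1) i with h4 | h4
        · rw [hp _ (2 * i - 1) (by omega) (by omega) (by split_ifs <;> omega),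
            hp _ (2 * i + 1) (by omega) (by omega) (by split_ifs <;> omega)]
          exact h1 i (by omega) (by omega)
        · obtain rfl : i = k + 1 := by omega
          rw [hp _ 1 (by omega) (by omega) (by split_ifs <;> omega),
            hp _ (2 * (k + 1) + 1) (by omega) (by omega) (by split_ifs <;> omega)]
          by_contra hc
          have hne : pimg d (2 * (k + 1) + 1) ≠ pimg d 1 := fun h => by
            have := pimg_inj d (by omega) (by omega) (by omega) (by omega) h
            omega
          have := hmax (k + 1) ⟨by omega, by omega⟩
          omega
    · rcases Nat.lt_or_ge (k + 1) i with h4 | h4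
      · rw [hp _ (2 * i - 1) (by omega) (by omega) (by split_ifs <;> omega),
          hp _ (2 * i) (by omega) (by omega) (by split_ifs <;> omega)]
        exact h2 i (by omega) (by omega)
      · rcases Nat.lt_or_ge k i with h3 | h3
        · rw [hp _ 1 (by omega) (by omega) (by split_ifs <;> omega),
            hp _ 2 (by omega) (by omega) (by split_ifs <;> omega)]
          exact h2 1 (by omega) (by omega)
        · rw [hp _ (2 * (i + 1) - 1) (by omega) (by omega) (by split_ifs <;> omega),
            hp _ (2 * (i + 1)) (by omega) (by omega) (by split_ifs <;> omega)]
          exact h2 (i + 1) (by omega) (by omega)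

lemma mem_bbs_mul_image_Hset_iff {n : ℕ} (hn : 4 ≤ n) (a : Equiv.Perm (Fin n)) :
    a ∈ {bbs n 1} * (Hset 4 2).image (shiftEmb n 0 4) ↔
      (∀ i, 4 < i → i ≤ n → pimg a i = i) ∧
        pimg a 3 < pimg a 1 ∧ pimg a 1 < pimg a 2 ∧ pimg a 3 < pimg a 4 := by
  have hb : ∀ i, 1 ≤ i → i ≤ n → pimg (bbs n 1) i =
      if i = 1 ∨ i = 2 then i + 2 else if i = 3 ∨ i = 4 then i - 2 else i :=
    fun i h1 hi => pimg_bbs le_rfl (by omega) h1 hi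
  have hbb : bbs n 1 * bbs n 1 = 1 := by
    refine perm_ext_pimg fun i h1 hi => ?_
    rw [pimg_mul _ _ h1 hi, pimg_one h1 hi, hb i h1 hi, hb _ (by split_ifs <;> omega)
      (by split_ifs <;> omega)]
    split_ifs <;> omega
  have hH : ∀ h : Equiv.Perm (Fin 4), h ∈ Hset 4 2 ↔
      pimg h 1 < pimg h 3 ∧ pimg h 1 < pimg h 2 ∧ pimg h 3 < pimg h 4 := by
    intro h
    rw [mem_Hset_iff (f := 2) (by norm_num)]
    constructor
    · rintro ⟨h1, h2⟩
      exact ⟨h1 1 (by omega) (by omega), h2 1 (by omega) (by omega), h2 2 (by omega) (by omega)⟩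
    · rintro ⟨h1, h2, h3⟩
      constructor
      · intro i hi hi'
        obtain rfl : i = 1 := by omega
        exact h1
      · intro i hi hi'
        obtain rfl | rfl : i = 1 ∨ i = 2 := by omega
        · exact h2
        · exact h3
  have hs : ∀ (h : Equiv.Perm (Fin 4)) i, 1 ≤ i → i ≤ 4 →
      pimg (shiftEmb n 0 4 h) i = pimg h i := fun h i h1 hi => by
    rw [pimg_shiftEmb_of_mem (by omega) h (by omega) (by omega)]; simp
  have hbv : ∀ h : Equiv.Perm (Fin n), pimg (bbs n 1 * h) 1 = pimg h 3 ∧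
      pimg (bbs n 1 * h) 2 = pimg h 4 ∧ pimg (bbs n 1 * h) 3 = pimg h 1 ∧
      pimg (bbs n 1 * h) 4 = pimg h 2 := by
    intro h
    refine ⟨?_, ?_, ?_, ?_⟩ <;> rw [pimg_mul _ _ (by omega) (by omega), hb _ (by omega) (by omega)]
      <;> rfl
  simp only [mem_mul, mem_singleton, mem_image]
  constructor
  · rintro ⟨_, rfl, _, ⟨h, hh, rfl⟩, rfl⟩
    rw [hH] at hh
    refine ⟨fun i hi hi' => ?_, ?_⟩
    · rw [pimg_mul _ _ (by omega) hi', hb i (by omega) hi', if_neg (by omega), if_neg (by omega),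
        pimg_shiftEmb_of_not_mem (by omega) _ (by omega) hi' (by omega)]
    · obtain ⟨e1, e2, e3, e4⟩ := hbv (shiftEmb n 0 4 h)
      rw [e1, e2, e3, e4, hs _ 1 (by omega) (by omega), hs _ 2 (by omega) (by omega),
        hs _ 3 (by omega) (by omega), hs _ 4 (by omega) (by omega)]
      omega
  · rintro ⟨hfix, ha⟩
    obtain ⟨h, hh⟩ := exists_shiftEmb_eq (n := n) (k := 0) (m := 4) (by omega) (bbs n 1 * a) (by
      intro i h1 hi hi'
      rw [pimg_mul _ _ (by omega) hi, hb i (by omega) hi, if_neg (by omega), if_neg (by omega),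
        hfix i (by omega) hi])
    refine ⟨_, rfl, _, ⟨h, ?_, rfl⟩, by rw [hh, ← mul_assoc, hbb, one_mul]⟩
    obtain ⟨e1, e2, e3, e4⟩ := hbv a
    rw [hH, ← hs _ 1 (by omega) (by omega), ← hs _ 2 (by omega) (by omega),
      ← hs _ 3 (by omega) (by omega), ← hs _ 4 (by omega) (by omega), hh, e1, e2, e3, e4]
    omega

lemma mem_image_Hset_iff {f : ℕ} (hf : 2 ≤ f) (b : Equiv.Perm (Fin (2 * f))) :
    b ∈ (Hset (2 * f - 4) (f - 2)).image (shiftEmb (2 * f) 4 (2 * f - 4)) ↔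
      (∀ i, 1 ≤ i → i ≤ 4 → pimg b i = i) ∧
      (∀ i, 3 ≤ i → i < f → pimg b (2 * i - 1) < pimg b (2 * i + 1)) ∧
      ∀ i, 3 ≤ i → i ≤ f → pimg b (2 * i - 1) < pimg b (2 * i) := by
  have hs : ∀ (h : Equiv.Perm (Fin (2 * f - 4))) i, 1 ≤ i → i ≤ 2 * f - 4 →
      pimg (shiftEmb (2 * f) 4 (2 * f - 4) h) (i + 4) = 4 + pimg h i := fun h i h1 hi => by
    rw [pimg_shiftEmb_of_mem (by omega) h (by omega) (by omega), Nat.add_sub_cancel]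
  simp only [mem_image]
  constructor
  · rintro ⟨h, hh, rfl⟩
    rw [mem_Hset_iff (by omega)] at hh
    refine ⟨fun i h1 hi => ?_, fun i hi hi' => ?_, fun i hi hi' => ?_⟩
    · exact pimg_shiftEmb_of_not_mem (by omega) _ h1 (by omega) (by omega)
    · have := hh.1 (i - 2) (by omega) (by omega)
      rw [show 2 * i - 1 = 2 * (i - 2) - 1 + 4 by omega,
        show 2 * i + 1 = 2 * (i - 2) + 1 + 4 by omega, hs _ _ (by omega) (by omega),
        hs _ _ (by omega) (by omega)]
      omega
    · have := hh.2 (i - 2) (by omega) (by omega)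
      rw [show 2 * i - 1 = 2 * (i - 2) - 1 + 4 by omega,
        show 2 * i = 2 * (i - 2) + 4 by omega, hs _ _ (by omega) (by omega),
        hs _ _ (by omega) (by omega)]
      omega
  · rintro ⟨hfix, h1, h2⟩
    obtain ⟨h, hh⟩ := exists_shiftEmb_eq (n := 2 * f) (k := 4) (m := 2 * f - 4) (by omega) b
      fun i h1 hi hi' => hfix i h1 (by omega)
    refine ⟨h, ?_, hh⟩
    rw [mem_Hset_iff (by omega)]
    refine ⟨fun i hi hi' => ?_, fun i hi hi' => ?_⟩
    · have := h1 (i + 2) (by omega) (by omega)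
      rw [show 2 * (i + 2) - 1 = 2 * i - 1 + 4 by omega,
        show 2 * (i + 2) + 1 = 2 * i + 1 + 4 by omega, ← hh, hs _ _ (by omega) (by omega),
        hs _ _ (by omega) (by omega)] at this
      omega
    · have := h2 (i + 2) (by omega) (by omega)
      rw [show 2 * (i + 2) - 1 = 2 * i - 1 + 4 by omega,
        show 2 * (i + 2) = 2 * i + 4 by omega, ← hh, hs _ _ (by omega) (by omega),
        hs _ _ (by omega) (by omega)] at this
      omega

lemma mem_image_Dset_iff {n : ℕ} (hn : 4 ≤ n) (c : Equiv.Perm (Fin n)) :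
    c ∈ (Dset (n - 1) [3, n - 4]).image (shiftEmb n 1 (n - 1)) ↔
      pimg c 1 = 1 ∧
      ∀ i j, 1 ≤ i → i < j → j ≤ n → (j ≤ 4 ∨ 4 < i) → pimg c i < pimg c j := by
  have hs : ∀ (h : Equiv.Perm (Fin (n - 1))) i, 2 ≤ i → i ≤ n →
      pimg (shiftEmb n 1 (n - 1) h) i = 1 + pimg h (i - 1) := fun h i h1 hi =>
    pimg_shiftEmb_of_mem (by omega) h (by omega) (by omega)
  simp only [mem_image]
  constructor
  · rintro ⟨h, hh, rfl⟩
    rw [mem_Dset_pair_iff (by omega)] at hh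
    have hone : pimg (shiftEmb n 1 (n - 1) h) 1 = 1 :=
      pimg_shiftEmb_of_not_mem (by omega) _ (by omega) (by omega) (by omega)
    refine ⟨hone, fun i j hi hij hj hij' => ?_⟩
    rcases Nat.lt_or_ge 1 i with h1 | h1
    · have := hh (i - 1) (j - 1) (by omega) (by omega) (by omega) (by omega)
      rw [hs _ _ (by omega) (by omega), hs _ _ (by omega) hj]
      omega
    · obtain rfl : i = 1 := by omega
      have := one_le_pimg h (i := j - 1) (by omega) (by omega)
      rw [hone, hs _ _ (by omega) hj]
      omega
  · rintro ⟨hone, hinc⟩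
    obtain ⟨h, hh⟩ := exists_shiftEmb_eq (n := n) (k := 1) (m := n - 1) (by omega) c
      fun i h1 hi hi' => by
        obtain rfl : i = 1 := by omega
        exact hone
    refine ⟨h, ?_, hh⟩
    rw [mem_Dset_pair_iff (by omega)]
    intro i j hi hij hj hij'
    have := hinc (i + 1) (j + 1) (by omega) (by omega) (by omega) (by omega)
    rw [← hh, hs _ _ (by omega) (by omega), hs _ _ (by omega) (by omega)] at this
    simpa using this

lemma isSwappedSorted_mul_mul {f : ℕ} (hf : 2 ≤ f) {a b c : Equiv.Perm (Fin (2 * f))}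
    (ha : a ∈ {bbs (2 * f) 1} * (Hset 4 2).image (shiftEmb (2 * f) 0 4))
    (hb : b ∈ (Hset (2 * f - 4) (f - 2)).image (shiftEmb (2 * f) 4 (2 * f - 4)))
    (hc : c ∈ (Dset (2 * f - 1) [3, 2 * f - 4]).image (shiftEmb (2 * f) 1 (2 * f - 1))) :
    IsSwappedSorted f (a * b * c) := by
  rw [mem_bbs_mul_image_Hset_iff (by omega)] at ha
  rw [mem_image_Hset_iff hf] at hb
  rw [mem_image_Dset_iff (by omega)] at hc
  obtain ⟨ha, ha31, ha12, ha34⟩ := ha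
  obtain ⟨hb, hbo, hbp⟩ := hb
  obtain ⟨hc1, hc⟩ := hc
  have hlow : ∀ i j, 1 ≤ i → i ≤ 4 → 1 ≤ j → j ≤ 4 → pimg a i < pimg a j →
      pimg (a * b * c) i < pimg (a * b * c) j := by
    intro i j hi hi' hj hj' h
    rw [pimg_mul_mul_of_le c ha hb hi (by omega) hi', pimg_mul_mul_of_le c ha hb hj (by omega) hj']
    have := pimg_le_of_fix_gt ha hj (by omega) hj'
    exact hc _ _ (one_le_pimg a hi (by omega)) h (by omega) (Or.inl this)
  have hhigh : ∀ i j, 4 < i → i ≤ 2 * f → 4 < j → j ≤ 2 * f → pimg b i < pimg b j →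
      pimg (a * b * c) i < pimg (a * b * c) j := by
    intro i j hi hi' hj hj' h
    rw [pimg_mul_mul_of_gt b c ha hi' hi, pimg_mul_mul_of_gt b c ha hj' hj]
    have := lt_pimg_of_fix_le hb hi' hi
    exact hc _ _ (by omega) h (pimg_le b (by omega) hj') (Or.inr this)
  have h3 : pimg (a * b * c) 3 = 1 := by
    have ha3 : pimg a 3 = 1 := by
      have b1 := pimg_le_of_fix_gt ha (i := 1) (by omega) (by omega) (by omega)
      have b2 := pimg_le_of_fix_gt ha (i := 2) (by omega) (by omega) (by omega)
      have b4 := pimg_le_of_fix_gt ha (i := 4) (by omega) (by omega) (by omega)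
      have b3 := one_le_pimg a (i := 3) (by omega) (by omega)
      have n1 : pimg a 1 ≠ pimg a 4 := fun h => by
        have := pimg_inj a (by omega) (by omega) (by omega) (by omega) h
        omega
      have n2 : pimg a 2 ≠ pimg a 4 := fun h => by
        have := pimg_inj a (by omega) (by omega) (by omega) (by omega) h
        omega
      omega
    rw [pimg_mul_mul_of_le c ha hb (by omega) (by omega) (by omega), ha3, hc1]
  refine ⟨fun i hi hi' => ?_, fun i hi hi' => ?_, ?_⟩
  · rcases Nat.lt_or_ge 2 i with h | h
    · exact hhigh _ _ (by omega) (by omega) (by omega) (by omega) (hbp i h hi')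
    · obtain rfl | rfl : i = 1 ∨ i = 2 := by omega
      · exact hlow 1 2 (by omega) (by omega) (by omega) (by omega) ha12
      · exact hlow 3 4 (by omega) (by omega) (by omega) (by omega) ha34
  · rcases Nat.lt_or_ge 2 i with h | h
    · exact hhigh _ _ (by omega) (by omega) (by omega) (by omega) (hbo i h hi')
    · obtain rfl : i = 2 := by omega
      have h5 := one_le_pimg (a * b * c) (i := 5) (by omega) (by omega)
      have n5 : pimg (a * b * c) 5 ≠ pimg (a * b * c) 3 := fun h => by
        have := pimg_inj _ (by omega) (by omega) (by omega) (by omega) h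
        omega
      change pimg (a * b * c) 3 < pimg (a * b * c) 5
      omega
  · exact hlow 3 1 (by omega) (by omega) (by omega) (by omega) ha31

lemma pimg_three_of_isSwappedSorted {f : ℕ} (hf : 2 ≤ f) {d : Equiv.Perm (Fin (2 * f))}
    (hd : IsSwappedSorted f d) : pimg d 3 = 1 := by
  obtain ⟨h2, h1, h0⟩ := hd
  set i := pimg d⁻¹ 1 with hi
  have hi1 : 1 ≤ i := one_le_pimg _ le_rfl (by omega)
  have hin : i ≤ 2 * f := pimg_le _ le_rfl (by omega)
  have hdi : pimg d i = 1 := pimg_pimg_inv d le_rfl (by omega)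
  have hpos : ∀ j, 1 ≤ j → j ≤ 2 * f → 1 ≤ pimg d j := fun j => one_le_pimg d
  by_cases he : i % 2 = 0
  · have h3 := h2 (i / 2) (by omega) (by omega)
    have h4 := hpos (2 * (i / 2) - 1) (by omega) (by omega)
    rw [show 2 * (i / 2) = i by omega] at h3 h4
    omega
  · have h4 := hpos 3 (by omega) (by omega)
    obtain h5 | h5 | h5 : i = 1 ∨ i = 3 ∨ 5 ≤ i := by omega
    · rw [h5] at hdi; omega
    · rw [h5] at hdi; exact hdi
    · have := odd_pimg_lt h1 (i := 2) (j := (i + 1) / 2) le_rfl (by omega) (by omega)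
      rw [show 2 * ((i + 1) / 2) - 1 = i by omega] at this
      change pimg d 3 < _ at this
      omega

lemma exists_factorization_of_isSwappedSorted {f : ℕ} (hf : 2 ≤ f)
    {d : Equiv.Perm (Fin (2 * f))} (hd : IsSwappedSorted f d) :
    ∃ a b c : Equiv.Perm (Fin (2 * f)),
      a ∈ {bbs (2 * f) 1} * (Hset 4 2).image (shiftEmb (2 * f) 0 4) ∧
      b ∈ (Hset (2 * f - 4) (f - 2)).image (shiftEmb (2 * f) 4 (2 * f - 4)) ∧
      c ∈ (Dset (2 * f - 1) [3, 2 * f - 4]).image (shiftEmb (2 * f) 1 (2 * f - 1)) ∧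
      d = a * b * c := by
  have hd3 := pimg_three_of_isSwappedSorted hf hd
  obtain ⟨h2, h1, h0⟩ := hd
  obtain ⟨a, b, c, rfl, ha, hb', hc⟩ := exists_cut_factorization 4 d
  have hb : ∀ i, 1 ≤ i → i ≤ 4 → pimg b i = i := fun i hi hi' => hb' i hi hi' (by omega)
  have hlow : ∀ i j, 1 ≤ i → i ≤ 4 → 1 ≤ j → j ≤ 4 →
      pimg (a * b * c) i < pimg (a * b * c) j → pimg a i < pimg a j := by
    intro i j hi hi' hj hj' h
    rw [pimg_mul_mul_of_le c ha hb hi (by omega) hi',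
      pimg_mul_mul_of_le c ha hb hj (by omega) hj'] at h
    by_contra hlt
    rcases lt_or_eq_of_le (not_lt.1 hlt) with h3 | h3
    · exact h.asymm (hc _ _ (one_le_pimg a hj (by omega)) h3 (pimg_le a hi (by omega))
        (Or.inl (pimg_le_of_fix_gt ha hi (by omega) hi')))
    · rw [h3] at h; exact lt_irrefl _ h
  have hhigh : ∀ i j, 4 < i → i ≤ 2 * f → 4 < j → j ≤ 2 * f →
      pimg (a * b * c) i < pimg (a * b * c) j → pimg b i < pimg b j := by
    intro i j hi hi' hj hj' h
    rw [pimg_mul_mul_of_gt b c ha hi' hi, pimg_mul_mul_of_gt b c ha hj' hj] at h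
    by_contra hlt
    rcases lt_or_eq_of_le (not_lt.1 hlt) with h3 | h3
    · exact h.asymm (hc _ _ (one_le_pimg b (by omega) hj') h3 (pimg_le b (by omega) hi')
        (Or.inr (lt_pimg_of_fix_le hb hj' hj)))
    · rw [h3] at h; exact lt_irrefl _ h
  refine ⟨a, b, c, ?_, ?_, ?_, rfl⟩
  · rw [mem_bbs_mul_image_Hset_iff (by omega)]
    exact ⟨ha, hlow 3 1 (by omega) (by omega) (by omega) (by omega) h0,
      hlow 1 2 (by omega) (by omega) (by omega) (by omega) (h2 1 (by omega) (by omega)),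
      hlow 3 4 (by omega) (by omega) (by omega) (by omega) (h2 2 (by omega) (by omega))⟩
  · rw [mem_image_Hset_iff hf]
    exact ⟨hb, fun i hi hi' => hhigh _ _ (by omega) (by omega) (by omega) (by omega)
        (h1 i (by omega) hi'),
      fun i hi hi' => hhigh _ _ (by omega) (by omega) (by omega) (by omega)
        (h2 i (by omega) hi')⟩
  · rw [mem_image_Dset_iff (by omega)]
    refine ⟨?_, hc⟩
    rw [pimg_mul_mul_of_le c ha hb (by omega) (by omega) (by omega)] at hd3
    have b3 := one_le_pimg a (i := 3) (by omega) (by omega)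
    have c1 := one_le_pimg c (i := 1) (by omega) (by omega)
    rcases Nat.lt_or_ge 1 (pimg a 3) with h | h
    · have := hc 1 (pimg a 3) le_rfl h (pimg_le a (by omega) (by omega))
        (Or.inl (pimg_le_of_fix_gt ha (by omega) (by omega) (by omega)))
      omega
    · rwa [show pimg a 3 = 1 by omega] at hd3

end Characterizations

open scoped Classical in
/-- For `f ≥ 2`, in `S_{2f}`:
`𝕤_1 · 𝔻_{(1,f-2)}^{{2,…,f}} · H_f(2f) = (𝕤_1 H_2^{{1,…,4}}) · H_{f-2}^{{5,…,2f}} · D_{(3,2f-4)}^{{2,…,2f}}`,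
with unique triple factorizations and lengths adding, and this set equals the set of
`d ∈ D_{(2,…,2)}` with `(3)d < (5)d < ⋯ < (2f-1)d` and `(1)d > (3)d`. -/
theorem statement10 (f : ℕ) (hf : 2 ≤ f) :
    {bbs (2 * f) 1} * bbD1' f * Hset (2 * f) f =
      ({bbs (2 * f) 1} * (Hset 4 2).image (shiftEmb (2 * f) 0 4)) *
        (Hset (2 * f - 4) (f - 2)).image (shiftEmb (2 * f) 4 (2 * f - 4)) *
        (Dset (2 * f - 1) [3, 2 * f - 4]).image (shiftEmb (2 * f) 1 (2 * f - 1)) ∧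
    (∀ d ∈ {bbs (2 * f) 1} * bbD1' f * Hset (2 * f) f,
      ∃! abc : Equiv.Perm (Fin (2 * f)) × Equiv.Perm (Fin (2 * f)) × Equiv.Perm (Fin (2 * f)),
        abc.1 ∈ {bbs (2 * f) 1} * (Hset 4 2).image (shiftEmb (2 * f) 0 4) ∧
        abc.2.1 ∈ (Hset (2 * f - 4) (f - 2)).image (shiftEmb (2 * f) 4 (2 * f - 4)) ∧
        abc.2.2 ∈ (Dset (2 * f - 1) [3, 2 * f - 4]).image (shiftEmb (2 * f) 1 (2 * f - 1)) ∧
        d = abc.1 * abc.2.1 * abc.2.2 ∧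
        len d = len abc.1 + len abc.2.1 + len abc.2.2) ∧
    {bbs (2 * f) 1} * bbD1' f * Hset (2 * f) f =
      (Dset (2 * f) (List.replicate f 2)).filter
        (fun d => (∀ i ∈ Finset.Icc 1 (f - 2), pimg d (2 * i + 1) < pimg d (2 * i + 3)) ∧
          pimg d 3 < pimg d 1) := by
  refine ⟨?_, ?_, ?_⟩
  · ext d
    rw [mem_bbs_mul_bbD1'_mul_Hset_iff hf, mem_mul]
    constructor
    · intro hd
      obtain ⟨a, b, c, ha, hb, hc, rfl⟩ := exists_factorization_of_isSwappedSorted hf hd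
      exact ⟨a * b, mul_mem_mul ha hb, c, hc, rfl⟩
    · rintro ⟨_, hab, c, hc, rfl⟩
      obtain ⟨a, ha, b, hb, rfl⟩ := mem_mul.1 hab
      exact isSwappedSorted_mul_mul hf ha hb hc
  · intro d hd
    rw [mem_bbs_mul_bbD1'_mul_Hset_iff hf] at hd
    obtain ⟨a, b, c, ha, hb, hc, rfl⟩ := exists_factorization_of_isSwappedSorted hf hd
    have ha' := (mem_bbs_mul_image_Hset_iff (by omega) a).1 ha
    have hb' := (mem_image_Hset_iff hf b).1 hb
    have hc' := (mem_image_Dset_iff (by omega) c).1 hc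
    refine ⟨(a, b, c), ⟨ha, hb, hc, rfl, len_mul_mul_of_cut ha'.1 hb'.1 hc'.2⟩, ?_⟩
    rintro ⟨a₁, b₁, c₁⟩ ⟨ha₁, hb₁, hc₁, heq, -⟩
    obtain ⟨rfl, rfl, rfl⟩ := cut_factorization_unique (m := 4) ha'.1 hb'.1 hc'.2
      ((mem_bbs_mul_image_Hset_iff (by omega) a₁).1 ha₁).1 ((mem_image_Hset_iff hf b₁).1 hb₁).1
      ((mem_image_Dset_iff (by omega) c₁).1 hc₁).2 heq
    rfl
  · ext d
    rw [mem_bbs_mul_bbD1'_mul_Hset_iff hf, ← mem_filter_Dset_iff hf]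
    convert (mem_filter (s := Dset (2 * f) (List.replicate f 2))).symm
    exact Iff.rfl
end BMWPaper
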